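/- arXiv:0706.4055 — 3 statements merged into one kernel-verified Lean document; each statement's English description precedes it below -/
import Mathlib

section
/- Let ψ : ℝ → [0,1] be a smooth function supported in [−2,2] and equal to 1 on [−1,1]. For N > 0 define F_N, G : ℝ³ → [0,∞) by F_N(ξ,μ,τ) = ψ(ξ−N)·ψ((μ−√3ξ²)/ξ)·ψ(τ−ω(ξ,μ)) for ξ ≠ 0 (and 0 for ξ = 0), and G(ξ,μ,τ) = ψ(ξ−4)·ψ((μ+√3ξ²)/ξ)·ψ(τ−ω(ξ,μ)) for ξ ≠ 0 (and 0 for ξ = 0). Then there exist c > 0 and N₀ ≥ 1, depending only on ψ, such that for all N ≥ N₀ and all j ∈ ℤ with 100 ≤ 2^j ≤ N^{1/10}, ‖(F_N ∗ G) · 𝟏_{{2^{j−1} ≤ |τ−ω(ξ,μ)| ≤ 2^{j+1}}}‖_{L²(ℝ³)} ≥ c · 2^{j/2} · N^{−1/2}, where ∗ denotes convolution on ℝ³ and 𝟏_A is the indicator function of the set A. -/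
open MeasureTheory Real Set

noncomputable section

/-- The KP-I dispersion relation `ω(ξ,μ) = ξ³ + μ²/ξ`. -/
def disp (ξ μ : ℝ) : ℝ := ξ ^ 3 + μ ^ 2 / ξ

/-- Convolution on `ℝ³`. -/
def conv3 (f g : ℝ × ℝ × ℝ → ℝ) : ℝ × ℝ × ℝ → ℝ := fun p => ∫ q, f q * g (p - q)

/-- The `L²` norm of a function on `ℝ³`. -/
def L2₃ (f : ℝ × ℝ × ℝ → ℝ) : ℝ := (eLpNorm f 2 volume).toReal

/-- The function `F_N(ξ,μ,τ) = ψ(ξ−N)·ψ((μ−√3ξ²)/ξ)·ψ(τ−ω(ξ,μ))` for `ξ ≠ 0`, `0` for `ξ = 0`. -/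
def FN (ψ : ℝ → ℝ) (N : ℝ) : ℝ × ℝ × ℝ → ℝ := fun p =>
  if p.1 = 0 then 0 else
    ψ (p.1 - N) * ψ ((p.2.1 - Real.sqrt 3 * p.1 ^ 2) / p.1) * ψ (p.2.2 - disp p.1 p.2.1)

/-- The function `G(ξ,μ,τ) = ψ(ξ−4)·ψ((μ+√3ξ²)/ξ)·ψ(τ−ω(ξ,μ))` for `ξ ≠ 0`, `0` for `ξ = 0`. -/
def Gfun (ψ : ℝ → ℝ) : ℝ × ℝ × ℝ → ℝ := fun p =>
  if p.1 = 0 then 0 else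
    ψ (p.1 - 4) * ψ ((p.2.1 + Real.sqrt 3 * p.1 ^ 2) / p.1) * ψ (p.2.2 - disp p.1 p.2.1)

/-- The region of `ℝ³` obtained by shearing the box `[a, a + u] × [0, w] × [0, v]` along the
functions `f` and `h`. -/
def shearedBox (a u w v : ℝ) (f : ℝ → ℝ) (h : ℝ → ℝ → ℝ) : Set (ℝ × ℝ × ℝ) :=
  {q | q.1 ∈ Icc a (a + u) ∧ q.2.1 ∈ Icc (f q.1) (f q.1 + w) ∧
    q.2.2 ∈ Icc (h q.1 q.2.1) (h q.1 q.2.1 + v)}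

lemma measurableSet_shearedBox (a u w v : ℝ) {f : ℝ → ℝ} {h : ℝ → ℝ → ℝ} (hf : Measurable f)
    (hh : Measurable (Function.uncurry h)) : MeasurableSet (shearedBox a u w v f h) := by
  have h1 : Measurable fun q : ℝ × ℝ × ℝ => f q.1 := by fun_prop
  have h2 : Measurable fun q : ℝ × ℝ × ℝ => h q.1 q.2.1 :=
    hh.comp (g := Function.uncurry h) (f := fun q : ℝ × ℝ × ℝ => (q.1, q.2.1)) (by fun_prop)
  refine MeasurableSet.inter (measurable_fst measurableSet_Icc) (MeasurableSet.inter ?_ ?_)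
  · exact (measurableSet_le h1 (by fun_prop)).inter
      (measurableSet_le (by fun_prop) (h1.add_const w))
  · exact (measurableSet_le h2 (by fun_prop)).inter
      (measurableSet_le (by fun_prop) (h2.add_const v))

lemma volume_shearedBox (a u w v : ℝ) {f : ℝ → ℝ} {h : ℝ → ℝ → ℝ} (hf : Measurable f)
    (hh : Measurable (Function.uncurry h)) :
    volume (shearedBox a u w v f h) =
      ENNReal.ofReal v * ENNReal.ofReal w * ENNReal.ofReal u := by
  have hS := measurableSet_shearedBox a u w v hf hh
  rw [Measure.volume_eq_prod, Measure.prod_apply hS]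
  have key : ∀ x : ℝ, volume (Prod.mk x ⁻¹' shearedBox a u w v f h) =
      (Icc a (a + u)).indicator (fun _ => ENNReal.ofReal v * ENNReal.ofReal w) x := by
    intro x
    by_cases hx : x ∈ Icc a (a + u)
    · rw [indicator_of_mem hx, Measure.volume_eq_prod,
        Measure.prod_apply (measurable_prodMk_left hS)]
      have key' : ∀ y : ℝ, volume (Prod.mk y ⁻¹' (Prod.mk x ⁻¹' shearedBox a u w v f h)) =
          (Icc (f x) (f x + w)).indicator (fun _ => ENNReal.ofReal v) y := by
        intro y
        by_cases hy : y ∈ Icc (f x) (f x + w)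
        · have : Prod.mk y ⁻¹' (Prod.mk x ⁻¹' shearedBox a u w v f h) =
              Icc (h x y) (h x y + v) := by
            ext z
            exact ⟨fun hz => hz.2.2, fun hz => ⟨hx, hy, hz⟩⟩
          rw [indicator_of_mem hy, this, Real.volume_Icc, add_sub_cancel_left]
        · have : Prod.mk y ⁻¹' (Prod.mk x ⁻¹' shearedBox a u w v f h) = ∅ :=
            eq_empty_of_forall_notMem fun z hz => hy hz.2.1
          rw [indicator_of_notMem hy, this, measure_empty]
      simp_rw [key']
      rw [lintegral_indicator_const measurableSet_Icc, Real.volume_Icc, add_sub_cancel_left]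
    · have : Prod.mk x ⁻¹' shearedBox a u w v f h = ∅ :=
        eq_empty_of_forall_notMem fun z hz => hx hz.1
      rw [indicator_of_notMem hx, this, measure_empty]
  simp_rw [key]
  rw [lintegral_indicator_const measurableSet_Icc, Real.volume_Icc, add_sub_cancel_left]

lemma measurable_disp : Measurable (Function.uncurry disp) := by
  unfold Function.uncurry disp
  fun_prop

/-- The resonance identity, with `μ₁ = √3 a² + a (μ / (a + b) - √3 (a - b)) + e`. -/
lemma resonance_eq {a b : ℝ} (ha : 0 < a) (hb : 0 < b) (μ e : ℝ) :
    disp a (√3 * a ^ 2 + a * (μ / (a + b) - √3 * (a - b)) + e) +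
      disp b (μ - (√3 * a ^ 2 + a * (μ / (a + b) - √3 * (a - b)) + e)) - disp (a + b) μ =
    2 * √3 * (a + b) * e + (a + b) * e ^ 2 / (a * b) := by
  have hk : √3 ^ 2 = 3 := Real.sq_sqrt (by norm_num)
  have hab : a + b ≠ 0 := by positivity
  generalize √3 = k at *
  obtain ⟨m, rfl⟩ : ∃ m, μ = m * (a + b) := ⟨μ / (a + b), by field_simp⟩
  rw [mul_div_cancel_right₀ _ hab]
  have h1 : k * a ^ 2 + a * (m - k * (a - b)) + e = a * (m + k * b) + e := by ring
  have h2 : m * (a + b) - (a * (m + k * b) + e) = b * (m - k * a) - e := by ring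
  rw [h1, h2]
  unfold disp
  field_simp
  linear_combination a * b * (a + b) * a * b * hk

lemma mem_Icc_of_FN_ne_zero {ψ : ℝ → ℝ} (hsupp : Function.support ψ ⊆ Icc (-2 : ℝ) 2) {N : ℝ}
    {q : ℝ × ℝ × ℝ} (hq : FN ψ N q ≠ 0) :
    q.1 - N ∈ Icc (-2 : ℝ) 2 ∧ (q.2.1 - √3 * q.1 ^ 2) / q.1 ∈ Icc (-2 : ℝ) 2 ∧
      q.2.2 - disp q.1 q.2.1 ∈ Icc (-2 : ℝ) 2 := by
  unfold FN at hq
  split_ifs at hq with h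
  · exact absurd rfl hq
  · simp only [ne_eq, mul_eq_zero, not_or] at hq
    exact ⟨hsupp hq.1.1, hsupp hq.1.2, hsupp hq.2⟩

lemma mem_Icc_of_Gfun_ne_zero {ψ : ℝ → ℝ} (hsupp : Function.support ψ ⊆ Icc (-2 : ℝ) 2)
    {q : ℝ × ℝ × ℝ} (hq : Gfun ψ q ≠ 0) :
    q.1 - 4 ∈ Icc (-2 : ℝ) 2 ∧ (q.2.1 + √3 * q.1 ^ 2) / q.1 ∈ Icc (-2 : ℝ) 2 ∧
      q.2.2 - disp q.1 q.2.1 ∈ Icc (-2 : ℝ) 2 := by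
  unfold Gfun at hq
  split_ifs at hq with h
  · exact absurd rfl hq
  · simp only [ne_eq, mul_eq_zero, not_or] at hq
    exact ⟨hsupp hq.1.1, hsupp hq.1.2, hsupp hq.2⟩

lemma exists_norm_bound {M : ℝ} (hM : 3 ≤ M) (k : ℝ) :
    ∃ R : ℝ, ∀ q : ℝ × ℝ × ℝ, q.1 - M ∈ Icc (-2 : ℝ) 2 →
      (q.2.1 + k * q.1 ^ 2) / q.1 ∈ Icc (-2 : ℝ) 2 →
      q.2.2 - disp q.1 q.2.1 ∈ Icc (-2 : ℝ) 2 → ‖q‖ ≤ R := by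
  have hc : ContinuousOn
      (fun y : ℝ × ℝ × ℝ =>
        (y.1, y.2.1 * y.1 - k * y.1 ^ 2, y.2.2 + disp y.1 (y.2.1 * y.1 - k * y.1 ^ 2)))
      (Icc (M - 2) (M + 2) ×ˢ Icc (-2 : ℝ) 2 ×ˢ Icc (-2 : ℝ) 2) := by
    unfold disp
    refine ContinuousOn.prodMk (by fun_prop) (ContinuousOn.prodMk (by fun_prop) ?_)
    refine ContinuousOn.add (by fun_prop) (ContinuousOn.add (by fun_prop) ?_)
    refine ContinuousOn.div (by fun_prop) (by fun_prop) fun y hy => ?_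
    have := hy.1.1
    linarith
  obtain ⟨R, hR⟩ :=
    ((isCompact_Icc.prod (isCompact_Icc.prod isCompact_Icc)).image_of_continuousOn
      hc).isBounded.exists_norm_le
  refine ⟨R, fun q h1 h2 h3 => hR q ⟨(q.1, (q.2.1 + k * q.1 ^ 2) / q.1,
    q.2.2 - disp q.1 q.2.1), ⟨⟨by linarith [h1.1], by linarith [h1.2]⟩, h2, h3⟩, ?_⟩⟩
  have hq : q.1 ≠ 0 := by linarith [h1.1]
  have : (q.2.1 + k * q.1 ^ 2) / q.1 * q.1 - k * q.1 ^ 2 = q.2.1 := by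
    rw [div_mul_cancel₀ _ hq]; ring
  simp only [this]
  ext <;> simp

lemma exists_FN_norm_bound {ψ : ℝ → ℝ} (hsupp : Function.support ψ ⊆ Icc (-2 : ℝ) 2) {N : ℝ}
    (hN : 3 ≤ N) : ∃ R : ℝ, ∀ q, FN ψ N q ≠ 0 → ‖q‖ ≤ R := by
  obtain ⟨R, hR⟩ := exists_norm_bound hN (-√3)
  refine ⟨R, fun q hq => ?_⟩
  obtain ⟨h1, h2, h3⟩ := mem_Icc_of_FN_ne_zero hsupp hq
  exact hR q h1 (by rwa [neg_mul, ← sub_eq_add_neg]) h3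

lemma exists_Gfun_norm_bound {ψ : ℝ → ℝ} (hsupp : Function.support ψ ⊆ Icc (-2 : ℝ) 2) :
    ∃ R : ℝ, ∀ q, Gfun ψ q ≠ 0 → ‖q‖ ≤ R := by
  obtain ⟨R, hR⟩ := exists_norm_bound (M := 4) (by norm_num) (√3)
  refine ⟨R, fun q hq => ?_⟩
  obtain ⟨h1, h2, h3⟩ := mem_Icc_of_Gfun_ne_zero hsupp hq
  exact hR q h1 h2 h3

lemma mul_mul_mem_Icc {x y z : ℝ} (hx : x ∈ Icc (0 : ℝ) 1) (hy : y ∈ Icc (0 : ℝ) 1)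
    (hz : z ∈ Icc (0 : ℝ) 1) : x * y * z ∈ Icc (0 : ℝ) 1 :=
  unitInterval.mul_mem (unitInterval.mul_mem hx hy) hz

lemma FN_mem_Icc {ψ : ℝ → ℝ} (hrange : ∀ s, ψ s ∈ Icc (0 : ℝ) 1) (N : ℝ) (q : ℝ × ℝ × ℝ) :
    FN ψ N q ∈ Icc (0 : ℝ) 1 := by
  unfold FN
  split_ifs
  · simp
  · exact mul_mul_mem_Icc (hrange _) (hrange _) (hrange _)

lemma Gfun_mem_Icc {ψ : ℝ → ℝ} (hrange : ∀ s, ψ s ∈ Icc (0 : ℝ) 1) (q : ℝ × ℝ × ℝ) :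
    Gfun ψ q ∈ Icc (0 : ℝ) 1 := by
  unfold Gfun
  split_ifs
  · simp
  · exact mul_mul_mem_Icc (hrange _) (hrange _) (hrange _)

lemma measurable_FN {ψ : ℝ → ℝ} (hψ : Measurable ψ) (N : ℝ) : Measurable (FN ψ N) := by
  unfold FN disp
  refine Measurable.ite (measurable_fst (measurableSet_singleton 0)) (by fun_prop) (by fun_prop)

lemma measurable_Gfun {ψ : ℝ → ℝ} (hψ : Measurable ψ) : Measurable (Gfun ψ) := by
  unfold Gfun disp
  refine Measurable.ite (measurable_fst (measurableSet_singleton 0)) (by fun_prop) (by fun_prop)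

lemma integrable_FN {ψ : ℝ → ℝ} (hψ : Measurable ψ) (hrange : ∀ s, ψ s ∈ Icc (0 : ℝ) 1)
    (hsupp : Function.support ψ ⊆ Icc (-2 : ℝ) 2) {N : ℝ} (hN : 3 ≤ N) :
    Integrable (FN ψ N) := by
  obtain ⟨R, hR⟩ := exists_FN_norm_bound hsupp hN
  have hsub : Function.support (FN ψ N) ⊆ Metric.closedBall 0 R := fun q hq => by
    simpa using hR q hq
  rw [← integrableOn_iff_integrable_of_support_subset hsub]
  refine Measure.integrableOn_of_bounded (M := 1) measure_closedBall_lt_top.ne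
    (measurable_FN hψ N).aestronglyMeasurable (Filter.Eventually.of_forall fun q => ?_)
  have := FN_mem_Icc hrange N q
  rw [Real.norm_of_nonneg this.1]
  exact this.2

lemma integrable_FN_mul_Gfun {ψ : ℝ → ℝ} (hψ : Measurable ψ)
    (hrange : ∀ s, ψ s ∈ Icc (0 : ℝ) 1) (hsupp : Function.support ψ ⊆ Icc (-2 : ℝ) 2) {N : ℝ}
    (hN : 3 ≤ N) (p : ℝ × ℝ × ℝ) : Integrable (fun q => FN ψ N q * Gfun ψ (p - q)) := by
  have hm : Measurable fun q : ℝ × ℝ × ℝ => Gfun ψ (p - q) :=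
    (measurable_Gfun hψ).comp (measurable_const.sub measurable_id)
  refine (integrable_FN hψ hrange hsupp hN).mul_bdd (c := 1) hm.aestronglyMeasurable
    (Filter.Eventually.of_forall fun q => ?_)
  have := Gfun_mem_Icc hrange (p - q)
  rw [Real.norm_of_nonneg this.1]
  exact this.2

lemma conv3_nonneg {ψ : ℝ → ℝ} (hrange : ∀ s, ψ s ∈ Icc (0 : ℝ) 1) (N : ℝ) (p : ℝ × ℝ × ℝ) :
    0 ≤ conv3 (FN ψ N) (Gfun ψ) p :=
  integral_nonneg fun q => mul_nonneg (FN_mem_Icc hrange N q).1 (Gfun_mem_Icc hrange _).1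

lemma conv3_le {ψ : ℝ → ℝ} (hψ : Measurable ψ) (hrange : ∀ s, ψ s ∈ Icc (0 : ℝ) 1)
    (hsupp : Function.support ψ ⊆ Icc (-2 : ℝ) 2) {N : ℝ} (hN : 3 ≤ N) (p : ℝ × ℝ × ℝ) :
    conv3 (FN ψ N) (Gfun ψ) p ≤ ∫ q, FN ψ N q :=
  integral_mono (integrable_FN_mul_Gfun hψ hrange hsupp hN p)
    (integrable_FN hψ hrange hsupp hN) fun q =>
      mul_le_of_le_one_right (FN_mem_Icc hrange N q).1 (Gfun_mem_Icc hrange _).2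

lemma eLpNorm_conv3_mul_indicator_lt_top {ψ : ℝ → ℝ} (hψ : Measurable ψ)
    (hrange : ∀ s, ψ s ∈ Icc (0 : ℝ) 1) (hsupp : Function.support ψ ⊆ Icc (-2 : ℝ) 2) {N : ℝ}
    (hN : 3 ≤ N) (E : Set (ℝ × ℝ × ℝ)) :
    eLpNorm (fun p => conv3 (FN ψ N) (Gfun ψ) p * E.indicator 1 p) 2 volume < ⊤ := by
  obtain ⟨R₁, hR₁⟩ := exists_FN_norm_bound hsupp hN
  obtain ⟨R₂, hR₂⟩ := exists_Gfun_norm_bound hsupp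
  set B : Set (ℝ × ℝ × ℝ) := Metric.closedBall 0 (R₁ + R₂)
  have hzero : ∀ p ∉ B, conv3 (FN ψ N) (Gfun ψ) p = 0 := by
    intro p hp
    refine integral_eq_zero_of_ae (Filter.Eventually.of_forall fun q => ?_)
    by_contra hne
    obtain ⟨h1, h2⟩ := mul_ne_zero_iff.mp hne
    refine hp (mem_closedBall_zero_iff.mpr ?_)
    calc ‖p‖ = ‖q + (p - q)‖ := by rw [add_sub_cancel]
      _ ≤ ‖q‖ + ‖p - q‖ := norm_add_le _ _
      _ ≤ R₁ + R₂ := add_le_add (hR₁ q h1) (hR₂ _ h2)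
  have hI : 0 ≤ ∫ q, FN ψ N q := integral_nonneg fun q => (FN_mem_Icc hrange N q).1
  refine lt_of_le_of_lt (eLpNorm_mono_real (g := B.indicator fun _ => ∫ q, FN ψ N q)
    fun p => ?_) (memLp_indicator_const 2 Metric.isClosed_closedBall.measurableSet _
      (Or.inr measure_closedBall_lt_top.ne)).eLpNorm_lt_top
  by_cases hp : p ∈ B
  · rw [indicator_of_mem hp, norm_mul, Real.norm_of_nonneg (conv3_nonneg hrange N p)]
    refine (mul_le_of_le_one_right (conv3_nonneg hrange N p) ?_).trans
      (conv3_le hψ hrange hsupp hN p)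
    by_cases hE : p ∈ E <;> simp [hE]
  · rw [hzero p hp, indicator_of_notMem hp, zero_mul, norm_zero]

/-- If `μ` is close to `√3 (N - 4) ξ` and `τ - ω(ξ,μ)` is in `[0, 2N]`, the product
`F_N(q) G(p - q)` equals one on a sheared box of `q`. -/
lemma FN_mul_Gfun_eq_one {ψ : ℝ → ℝ} (hone : ∀ s ∈ Icc (-1 : ℝ) 1, ψ s = 1) {N x μ τ a ν σ : ℝ}
    (hN : 1000 ≤ N) (hx : x ∈ Icc (N + 4 - 1 / 10) (N + 4 + 1 / 10))
    (hμ : μ / x - √3 * (N - 4) ∈ Icc (0 : ℝ) (1 / 10))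
    (hτ : τ - disp x μ ∈ Icc 0 (2 * N))
    (ha : a ∈ Icc (N - 1 / 10) (N + 1 / 10))
    (hν : ν - (√3 * a ^ 2 + a * (μ / x - √3 * (2 * a - x)) + (τ - disp x μ) / (2 * √3 * x)) ∈
      Icc 0 (1 / (8 * N)))
    (hσ : σ - disp a ν ∈ Icc (-1 : ℝ) 0) :
    FN ψ N (a, ν, σ) * Gfun ψ ((x, μ, τ) - (a, ν, σ)) = 1 := by
  obtain ⟨b, rfl⟩ : ∃ b, x = a + b := ⟨x - a, by ring⟩
  obtain ⟨hx1, hx2⟩ := hx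
  obtain ⟨ha1, ha2⟩ := ha
  have ha0 : 0 < a := by linarith
  have hb1 : 3.8 ≤ b := by linarith
  have hb2 : b ≤ 4.2 := by linarith
  have hb0 : 0 < b := by linarith
  have hk1 : 1.73 ≤ √3 := Real.le_sqrt_of_sq_le (by norm_num)
  have hk2 : √3 ≤ 1.74 := Real.sqrt_le_iff.mpr (by norm_num)
  have hR := resonance_eq ha0 hb0 μ
  set l := τ - disp (a + b) μ with hl
  set m := μ / (a + b) - √3 * (a - b) with hm
  have hm' : μ / (a + b) - √3 * (2 * a - (a + b)) = m := by rw [hm]; ring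
  rw [hm'] at hν
  obtain ⟨e, rfl⟩ : ∃ e, ν = √3 * a ^ 2 + a * m + e := ⟨ν - (√3 * a ^ 2 + a * m), by ring⟩
  specialize hR e
  have hmabs : |m| ≤ 0.65 := by
    rw [abs_le]
    constructor <;> nlinarith [hμ.1, hμ.2]
  set e₀ := l / (2 * √3 * (a + b)) with he₀
  have hxe₀ : 2 * √3 * (a + b) * e₀ = l := by
    rw [he₀]; field_simp
  have he₀0 : 0 ≤ e₀ := div_nonneg hτ.1 (by positivity)
  have he₀1 : e₀ ≤ 0.58 := by
    rw [he₀, div_le_iff₀ (by positivity)]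
    nlinarith [hτ.2]
  have hδ : (1 : ℝ) / (8 * N) ≤ 0.01 := by
    rw [div_le_iff₀ (by positivity)]; linarith
  have he1 : e₀ ≤ e := by linarith [hν.1]
  have he2 : e - e₀ ≤ 1 / (8 * N) := by linarith [hν.2]
  have he3 : e ≤ 0.6 := by linarith
  have he0 : 0 ≤ e := by linarith
  have hlin0 : 0 ≤ 2 * √3 * (a + b) * (e - e₀) := by
    have : 0 ≤ e - e₀ := by linarith
    positivity
  have hlin1 : 2 * √3 * (a + b) * (e - e₀) ≤ 0.45 := by
    calc 2 * √3 * (a + b) * (e - e₀) ≤ 2 * 1.74 * (N + 5) * (1 / (8 * N)) :=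
          mul_le_mul (mul_le_mul (by linarith) (by linarith) (by positivity) (by norm_num)) he2
            (by linarith) (by positivity)
      _ ≤ 0.45 := by
          rw [mul_one_div, div_le_iff₀ (by positivity)]
          linarith
  have hquad0 : 0 ≤ (a + b) * e ^ 2 / (a * b) := by positivity
  have hquad1 : (a + b) * e ^ 2 / (a * b) ≤ 0.1 := by
    rw [div_le_iff₀ (by positivity)]
    have h1 : e ^ 2 ≤ 0.36 := by nlinarith
    have h2 : (a + b) * e ^ 2 ≤ (a + b) * 0.36 := by gcongr
    have h3 : a * 3.8 ≤ a * b := by gcongr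
    linarith
  have hea : 0 ≤ e / a ∧ e / a ≤ 0.3 := ⟨by positivity, by
    rw [div_le_iff₀ ha0]; linarith⟩
  have heb : 0 ≤ e / b ∧ e / b ≤ 0.3 := ⟨by positivity, by
    rw [div_le_iff₀ hb0]; linarith⟩
  have hA : (√3 * a ^ 2 + a * m + e - √3 * a ^ 2) / a = m + e / a := by
    field_simp; ring
  have hB : (μ - (√3 * a ^ 2 + a * m + e) + √3 * b ^ 2) / b = m - e / b := by
    have : μ = (m + √3 * (a - b)) * (a + b) := by rw [hm]; field_simp; ring
    rw [this]; field_simp; ring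
  rw [abs_le] at hmabs
  have hF : FN ψ N (a, √3 * a ^ 2 + a * m + e, σ) = 1 := by
    simp only [FN, if_neg ha0.ne', hA]
    rw [hone _ ⟨by linarith, by linarith⟩, hone _ ⟨by linarith, by linarith⟩,
      hone _ ⟨by linarith [hσ.1], by linarith [hσ.2]⟩]
    norm_num
  have hG : Gfun ψ ((a + b, μ, τ) - (a, √3 * a ^ 2 + a * m + e, σ)) = 1 := by
    simp only [Gfun, Prod.mk_sub_mk, add_sub_cancel_left, if_neg hb0.ne', hB]
    rw [hone _ ⟨by linarith, by linarith⟩, hone _ ⟨by linarith, by linarith⟩,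
      hone _ ⟨by linarith [hσ.2], by linarith [hσ.1]⟩]
    norm_num
  rw [hF, hG, one_mul]

lemma conv3_lower_bound {ψ : ℝ → ℝ} (hψ : Measurable ψ) (hrange : ∀ s, ψ s ∈ Icc (0 : ℝ) 1)
    (hsupp : Function.support ψ ⊆ Icc (-2 : ℝ) 2) (hone : ∀ s ∈ Icc (-1 : ℝ) 1, ψ s = 1)
    {N x μ τ : ℝ} (hN : 1000 ≤ N) (hx : x ∈ Icc (N + 4 - 1 / 10) (N + 4 + 1 / 10))
    (hμ : μ / x - √3 * (N - 4) ∈ Icc (0 : ℝ) (1 / 10))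
    (hτ : τ - disp x μ ∈ Icc 0 (2 * N)) :
    1 / (40 * N) ≤ conv3 (FN ψ N) (Gfun ψ) (x, μ, τ) := by
  set f : ℝ → ℝ := fun a =>
    √3 * a ^ 2 + a * (μ / x - √3 * (2 * a - x)) + (τ - disp x μ) / (2 * √3 * x) with hf
  set A := shearedBox (N - 1 / 10) (1 / 5) (1 / (8 * N)) 1 f fun a ν => disp a ν - 1 with hA
  have hfm : Measurable f := by fun_prop
  have hhm : Measurable (Function.uncurry fun a ν => disp a ν - 1) :=
    measurable_disp.sub_const 1
  have hAm : MeasurableSet A := measurableSet_shearedBox _ _ _ _ hfm hhm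
  have hvol : volume A = ENNReal.ofReal (1 / (40 * N)) := by
    rw [hA, volume_shearedBox _ _ _ _ hfm hhm, ENNReal.ofReal_one, one_mul,
      ← ENNReal.ofReal_mul (by positivity)]
    congr 1
    field_simp
    norm_num
  have hreal : volume.real A = 1 / (40 * N) := by
    rw [measureReal_def, hvol, ENNReal.toReal_ofReal (by positivity)]
  rw [← hreal, ← integral_indicator_one hAm]
  refine integral_mono ((integrable_indicator_iff hAm).mpr
    (integrableOn_const (by rw [hvol]; exact ENNReal.ofReal_ne_top)))
    (integrable_FN_mul_Gfun hψ hrange hsupp (by linarith) _) fun q => ?_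
  by_cases hq : q ∈ A
  · rw [indicator_of_mem hq]
    obtain ⟨a, ν, σ⟩ := q
    obtain ⟨⟨h1, h2⟩, ⟨h3, h4⟩, h5, h6⟩ := hq
    dsimp only at h1 h2 h3 h4 h5 h6
    exact (FN_mul_Gfun_eq_one hone hN hx hμ hτ ⟨h1, by linarith⟩
      ⟨by linarith, by linarith⟩ ⟨by linarith, by linarith⟩).ge
  · rw [indicator_of_notMem hq]
    exact mul_nonneg (FN_mem_Icc hrange N q).1 (Gfun_mem_Icc hrange _).1

theorem counterexample_L2_lower_bound (ψ : ℝ → ℝ)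
    (hsmooth : ContDiff ℝ (⊤ : ℕ∞) ψ) (hrange : ∀ s, ψ s ∈ Icc (0:ℝ) 1)
    (hsupp : Function.support ψ ⊆ Icc (-2 : ℝ) 2)
    (hone : ∀ s ∈ Icc (-1 : ℝ) 1, ψ s = 1) :
    ∃ c : ℝ, 0 < c ∧ ∃ N₀ : ℝ, 1 ≤ N₀ ∧ ∀ N : ℝ, N₀ ≤ N → ∀ j : ℤ,
      (100 : ℝ) ≤ (2:ℝ) ^ j → (2:ℝ) ^ j ≤ N ^ (1/10 : ℝ) →
      c * (2:ℝ) ^ ((j : ℝ) / 2) * N ^ (-(1/2) : ℝ) ≤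
        L2₃ (fun p =>
          conv3 (FN ψ N) (Gfun ψ) p *
            ({q : ℝ × ℝ × ℝ | (2:ℝ) ^ (j - 1) ≤ |q.2.2 - disp q.1 q.2.1| ∧
                |q.2.2 - disp q.1 q.2.1| ≤ (2:ℝ) ^ (j + 1)}).indicator 1 p) := by
  have hψ : Measurable ψ := hsmooth.continuous.measurable
  refine ⟨1 / 400, by norm_num, 1000, by norm_num, fun N hN j _ hj => ?_⟩
  have hN0 : 0 < N := by linarith
  have hjm : (2 : ℝ) ^ (j - 1) = 2 ^ j / 2 := by rw [zpow_sub_one₀ two_ne_zero]; ring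
  have hjp : (2 : ℝ) ^ (j + 1) = 2 ^ j * 2 := zpow_add_one₀ two_ne_zero j
  have hjhalf : (2 : ℝ) ^ ((j : ℝ) / 2) = √(2 ^ j) := by
    rw [Real.sqrt_eq_rpow, ← Real.rpow_intCast, ← Real.rpow_mul (by norm_num)]
    ring_nf
  have hNhalf : N ^ (-(1 / 2) : ℝ) = (√N)⁻¹ := by
    rw [Real.rpow_neg hN0.le, Real.sqrt_eq_rpow]
  have hL0 : (0 : ℝ) < 2 ^ j := by positivity
  have hLN : (2 : ℝ) ^ j ≤ N := hj.trans
    ((Real.rpow_le_rpow_of_exponent_le (by linarith) (by norm_num)).trans (Real.rpow_one N).le)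
  rw [hjm, hjp, hjhalf, hNhalf]
  generalize (2 : ℝ) ^ j = L at hL0 hLN
  set E : Set (ℝ × ℝ × ℝ) :=
    {q | L / 2 ≤ |q.2.2 - disp q.1 q.2.1| ∧ |q.2.2 - disp q.1 q.2.1| ≤ L * 2}
  set S := shearedBox (N + 4 - 1 / 10) (1 / 5) (N / 10) L (fun x => x * (√3 * (N - 4)))
    fun x μ => disp x μ + L / 2 with hS
  have hfm : Measurable fun x : ℝ => x * (√3 * (N - 4)) := by fun_prop
  have hhm : Measurable (Function.uncurry fun x μ => disp x μ + L / 2) :=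
    measurable_disp.add_const _
  have hSm : MeasurableSet S := measurableSet_shearedBox _ _ _ _ hfm hhm
  have hvol : volume S = ENNReal.ofReal (N * L / 50) := by
    rw [hS, volume_shearedBox _ _ _ _ hfm hhm, ← ENNReal.ofReal_mul (by positivity),
      ← ENNReal.ofReal_mul (by positivity)]
    congr 1
    ring
  have hle : eLpNorm (S.indicator fun _ => 1 / (40 * N)) 2 volume ≤
      eLpNorm (fun p => conv3 (FN ψ N) (Gfun ψ) p * E.indicator 1 p) 2 volume := by
    refine eLpNorm_mono fun p => ?_
    by_cases hp : p ∈ S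
    · obtain ⟨x, μ, τ⟩ := p
      rw [indicator_of_mem hp]
      obtain ⟨⟨h1, h2⟩, ⟨h3, h4⟩, h5, h6⟩ := hp
      dsimp only at h1 h2 h3 h4 h5 h6
      have hx0 : 0 < x := by linarith
      have hpE : (x, μ, τ) ∈ E := by
        show L / 2 ≤ |τ - disp x μ| ∧ |τ - disp x μ| ≤ L * 2
        rw [abs_of_nonneg (by linarith)]
        constructor <;> linarith
      rw [indicator_of_mem hpE, Pi.one_apply, mul_one, Real.norm_of_nonneg (by positivity)]
      refine (conv3_lower_bound hψ hrange hsupp hone hN ⟨h1, by linarith⟩ ⟨?_, ?_⟩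
        ⟨by linarith, by linarith⟩).trans (le_abs_self _)
      · rw [sub_nonneg, le_div_iff₀ hx0]
        linarith
      · rw [sub_le_iff_le_add, div_le_iff₀ hx0]
        linarith
    · rw [indicator_of_notMem hp, norm_zero]
      exact norm_nonneg _
  have htop := eLpNorm_conv3_mul_indicator_lt_top hψ hrange hsupp (by linarith : 3 ≤ N) E
  refine le_trans ?_ (ENNReal.toReal_mono htop.ne hle)
  rw [eLpNorm_indicator_const hSm two_ne_zero ENNReal.ofNat_ne_top, hvol, ENNReal.toReal_mul,
    ← ENNReal.toReal_rpow, ENNReal.toReal_ofReal (by positivity), toReal_enorm,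
    Real.norm_of_nonneg (by positivity), ENNReal.toReal_ofNat, ← Real.sqrt_eq_rpow]
  have h8 : √(N * L / 64) = √N * √L / 8 := by
    rw [Real.sqrt_div (by positivity), Real.sqrt_mul hN0.le,
      show (64 : ℝ) = 8 ^ 2 by norm_num, Real.sqrt_sq (by norm_num)]
  calc 1 / 400 * √L * (√N)⁻¹ = 1 / 400 * √L * √N / N := by
        nth_rewrite 3 [← Real.sq_sqrt hN0.le]
        field_simp
    _ ≤ 1 / (40 * N) * (√N * √L / 8) := by
        rw [div_le_iff₀ hN0]
        have : 1 / (40 * N) * (√N * √L / 8) * N = 1 / 320 * √L * √N := by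
          field_simp
          norm_num
        rw [this]
        gcongr
        norm_num
    _ ≤ 1 / (40 * N) * √(N * L / 50) := by
        rw [← h8]
        gcongr
        norm_num
end
end

section
/- There exists a universal constant C > 0 with the following property. Let k, l ∈ ℤ with k ≤ 0 and l ≥ 0, let y, t ∈ ℝ with |t| ≤ 1, and let ξ ∈ ℝ with 2^{k−2} ≤ |ξ| ≤ 2^{k+2}. Then | ∫_ℝ μ₀(μ/2^l)² · e^{i(yμ + tμ²/ξ)} dμ | is bounded by: C·2^{l−k}·|y|^{−2} if |y| ≥ 100·2^{l−k}; C·2^{l/2}·|y|^{−1/2} if 1 ≤ |y| ≤ 100·2^{l−k}; and C·2^l if |y| ≤ 1. -/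
open MeasureTheory Real Set

noncomputable section

/-- The oscillatory integral `∫ μ₀(μ/2^l)² e^{i(yμ + tμ²/ξ)} dμ`. -/
def oscInt (μ₀ : ℝ → ℝ) (l : ℤ) (ξ y t : ℝ) : ℂ :=
  ∫ μ : ℝ, (((μ₀ (μ / 2 ^ l)) ^ 2 : ℝ) : ℂ) *
    Complex.exp (Complex.I * ((y * μ + t * μ ^ 2 / ξ : ℝ) : ℂ))

/-- The derivative of the quadratic oscillation `e^{i(As + Bs²)}`. -/
lemma hasDerivAt_cexp_quadratic (A B s : ℝ) :
    HasDerivAt (fun s : ℝ => Complex.exp (Complex.I * ((A * s + B * s ^ 2 : ℝ) : ℂ)))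
      (Complex.exp (Complex.I * ((A * s + B * s ^ 2 : ℝ) : ℂ)) *
        (Complex.I * ((A + 2 * B * s : ℝ) : ℂ))) s := by
  have h : HasDerivAt (fun s : ℝ => A * s + B * s ^ 2) (A + 2 * B * s) s := by
    have h1 := ((hasDerivAt_id s).const_mul A).add (((hasDerivAt_id s).pow 2).const_mul B)
    refine h1.congr_deriv ?_
    norm_num
    ring
  exact (h.ofReal_comp.const_mul Complex.I).cexp

lemma norm_cexp_I_mul_ofReal (x : ℝ) : ‖Complex.exp (Complex.I * (x : ℂ))‖ = 1 := by
  rw [mul_comm]; exact Complex.norm_exp_ofReal_mul_I x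

/-- Integration by parts against `e^{i(As + Bs²)}` on an interval without stationary points. -/
lemma integral_mul_cexp_quadratic_by_parts {A B a b : ℝ} {f f' : ℝ → ℝ}
    (hD : ∀ s ∈ uIcc a b, A + 2 * B * s ≠ 0)
    (hf : ∀ s ∈ uIcc a b, HasDerivAt f (f' s) s) (hf' : ContinuousOn f' (uIcc a b))
    (ha : f a = 0) (hb : f b = 0) :
    ∫ s in a..b, (f s : ℂ) * Complex.exp (Complex.I * ((A * s + B * s ^ 2 : ℝ) : ℂ)) =
      Complex.I * ∫ s in a..b,
        (((f' s * (A + 2 * B * s) - 2 * B * f s) / (A + 2 * B * s) ^ 2 : ℝ) : ℂ) *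
          Complex.exp (Complex.I * ((A * s + B * s ^ 2 : ℝ) : ℂ)) := by
  have hfc : ContinuousOn f (uIcc a b) := fun s hs => (hf s hs).continuousAt.continuousWithinAt
  have hec : Continuous fun s : ℝ => Complex.exp (Complex.I * ((A * s + B * s ^ 2 : ℝ) : ℂ)) := by
    fun_prop
  have hc1 : IntervalIntegrable (fun s : ℝ => (f s : ℂ) *
      Complex.exp (Complex.I * ((A * s + B * s ^ 2 : ℝ) : ℂ))) volume a b :=
    ((Complex.continuous_ofReal.comp_continuousOn hfc).mul hec.continuousOn).intervalIntegrable
  have hc2 : IntervalIntegrable (fun s : ℝ =>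
      (((f' s * (A + 2 * B * s) - 2 * B * f s) / (A + 2 * B * s) ^ 2 : ℝ) : ℂ) *
      Complex.exp (Complex.I * ((A * s + B * s ^ 2 : ℝ) : ℂ))) volume a b := by
    refine ((Complex.continuous_ofReal.comp_continuousOn ?_).mul
      hec.continuousOn).intervalIntegrable
    refine ContinuousOn.div (by fun_prop) (by fun_prop) fun s hs => pow_ne_zero 2 (hD s hs)
  have key := intervalIntegral.integral_eq_sub_of_hasDerivAt
    (f := fun s : ℝ => ((f s / (A + 2 * B * s) : ℝ) : ℂ) *
      Complex.exp (Complex.I * ((A * s + B * s ^ 2 : ℝ) : ℂ)))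
    (f' := fun s : ℝ => (((f' s * (A + 2 * B * s) - 2 * B * f s) / (A + 2 * B * s) ^ 2 : ℝ) : ℂ) *
          Complex.exp (Complex.I * ((A * s + B * s ^ 2 : ℝ) : ℂ)) +
        Complex.I * ((f s : ℂ) * Complex.exp (Complex.I * ((A * s + B * s ^ 2 : ℝ) : ℂ))))
    (a := a) (b := b) ?_ (hc2.add (hc1.const_mul _))
  · rw [intervalIntegral.integral_add hc2 (hc1.const_mul _),
      intervalIntegral.integral_const_mul] at key
    simp only [ha, hb, zero_div, Complex.ofReal_zero, zero_mul, sub_zero] at key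
    linear_combination (-Complex.I) * key +
      (∫ s in a..b, (f s : ℂ) * Complex.exp (Complex.I * ((A * s + B * s ^ 2 : ℝ) : ℂ))) *
        Complex.I_sq
  · intro s hs
    have hlin : HasDerivAt (fun s : ℝ => A + 2 * B * s) (2 * B) s := by
      simpa using ((hasDerivAt_id s).const_mul (2 * B)).const_add A
    have h := ((hf s hs).div hlin (hD s hs)).ofReal_comp.mul (hasDerivAt_cexp_quadratic A B s)
    refine h.congr_deriv ?_
    have hD' : ((A + 2 * B * s : ℝ) : ℂ) ≠ 0 := by exact_mod_cast hD s hs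
    have e : ((f s / (A + 2 * B * s) : ℝ) : ℂ) * ((A + 2 * B * s : ℝ) : ℂ) = f s := by
      rw [← Complex.ofReal_mul, div_mul_cancel₀ _ (hD s hs)]
    simp only [mul_comm (f s) (2 * B), Pi.div_apply]
    linear_combination Complex.exp (Complex.I * ((A * s + B * s ^ 2 : ℝ) : ℂ)) * Complex.I * e

/-- Second-order decay of a quadratic oscillatory integral with no stationary point. -/
lemma norm_integral_mul_cexp_quadratic_le_of_nonstationary {A B M : ℝ} {f f' f'' : ℝ → ℝ}
    (hA : A ≠ 0) (hAB : 10 * |B| ≤ |A|)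
    (hf : ∀ s, HasDerivAt f (f' s) s) (hf' : ∀ s, HasDerivAt f' (f'' s) s)
    (hf'' : Continuous f'')
    (hM : ∀ s ∈ Icc (-2 : ℝ) 2, |f s| ≤ M) (hM' : ∀ s ∈ Icc (-2 : ℝ) 2, |f' s| ≤ M)
    (hM'' : ∀ s ∈ Icc (-2 : ℝ) 2, |f'' s| ≤ M)
    (h1 : f (-2) = 0) (h2 : f 2 = 0) (h1' : f' (-2) = 0) (h2' : f' 2 = 0) :
    ‖∫ s in (-2 : ℝ)..2, (f s : ℂ) * Complex.exp (Complex.I * ((A * s + B * s ^ 2 : ℝ) : ℂ))‖ ≤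
      44 * M / |A| ^ 2 := by
  have hA0 : 0 < |A| := abs_pos.mpr hA
  have hI : uIcc (-2 : ℝ) 2 = Icc (-2) 2 := uIcc_of_le (by norm_num)
  have hDl : ∀ s ∈ Icc (-2 : ℝ) 2, |A| / 2 ≤ |A + 2 * B * s| := by
    intro s hs
    have hs' : |s| ≤ 2 := abs_le.mpr ⟨hs.1, hs.2⟩
    have e1 : |2 * B * s| ≤ 4 * |B| := by
      rw [abs_mul, abs_mul, abs_two]
      nlinarith [abs_nonneg B]
    have e2 : |A| ≤ |A + 2 * B * s| + |2 * B * s| := by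
      simpa using abs_sub (A + 2 * B * s) (2 * B * s)
    linarith
  have hD : ∀ s ∈ uIcc (-2 : ℝ) 2, A + 2 * B * s ≠ 0 := by
    intro s hs
    rw [hI] at hs
    exact abs_pos.mp (by linarith [hDl s hs])
  have hfc : Continuous f := continuous_iff_continuousAt.mpr fun s => (hf s).continuousAt
  have hfc' : Continuous f' := continuous_iff_continuousAt.mpr fun s => (hf' s).continuousAt
  rw [integral_mul_cexp_quadratic_by_parts hD (fun s _ => hf s) hfc'.continuousOn h1 h2,
    integral_mul_cexp_quadratic_by_parts (f' := fun s => f'' s / (A + 2 * B * s) -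
      4 * B * (f' s * (A + 2 * B * s) - 2 * B * f s) / (A + 2 * B * s) ^ 3) hD ?_ ?_
      (by simp [h1, h1']) (by simp [h2, h2'])]
  · rw [norm_mul, norm_mul, Complex.norm_I, one_mul, one_mul]
    have hb : ∀ s ∈ uIoc (-2 : ℝ) 2, ‖((((f'' s / (A + 2 * B * s) -
      4 * B * (f' s * (A + 2 * B * s) - 2 * B * f s) / (A + 2 * B * s) ^ 3) * (A + 2 * B * s) -
      2 * B * ((f' s * (A + 2 * B * s) - 2 * B * f s) / (A + 2 * B * s) ^ 2)) /
      (A + 2 * B * s) ^ 2 : ℝ) : ℂ) *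
        Complex.exp (Complex.I * ((A * s + B * s ^ 2 : ℝ) : ℂ))‖ ≤ 11 * M / |A| ^ 2 := by
      intro s hs
      have hs' : s ∈ Icc (-2 : ℝ) 2 := by
        rw [uIoc_of_le (by norm_num)] at hs
        exact ⟨hs.1.le, hs.2⟩
      have hne := hD s (hI ▸ hs')
      have hl := hDl s hs'
      rw [norm_mul, norm_cexp_I_mul_ofReal, mul_one, Complex.norm_real, Real.norm_eq_abs]
      have m0 := hM s hs'
      have m1 := hM' s hs'
      have m2 := hM'' s hs'
      generalize f s = p at *
      generalize f' s = q at *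
      generalize f'' s = r at *
      generalize hDef : A + 2 * B * s = D at *
      have hM0 : 0 ≤ M := (abs_nonneg p).trans m0
      have e : ((r / D - 4 * B * (q * D - 2 * B * p) / D ^ 3) * D -
          2 * B * ((q * D - 2 * B * p) / D ^ 2)) / D ^ 2 =
          r / D ^ 2 - 6 * B * q / D ^ 3 + 12 * B ^ 2 * p / D ^ 4 := by
        field_simp
        ring
      rw [e]
      have t2 : |r / D ^ 2| ≤ 4 * M / |A| ^ 2 := by
        rw [abs_div, abs_pow]
        calc |r| / |D| ^ 2 ≤ M / (|A| / 2) ^ 2 := by gcongr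
          _ = _ := by field_simp; ring
      have t1 : |6 * B * q / D ^ 3| ≤ 5 * M / |A| ^ 2 := by
        rw [abs_div, abs_pow, abs_mul, abs_mul, abs_of_pos (by norm_num : (0 : ℝ) < 6)]
        calc 6 * |B| * |q| / |D| ^ 3 ≤ 6 * (|A| / 10) * M / (|A| / 2) ^ 3 := by
              gcongr; linarith
          _ = (24 / 5) * M / |A| ^ 2 := by field_simp; ring
          _ ≤ _ := by gcongr; norm_num
      have t0 : |12 * B ^ 2 * p / D ^ 4| ≤ 2 * M / |A| ^ 2 := by
        rw [abs_div, abs_pow, abs_mul, abs_mul, abs_pow, abs_of_pos (by norm_num : (0 : ℝ) < 12)]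
        calc 12 * |B| ^ 2 * |p| / |D| ^ 4 ≤ 12 * (|A| / 10) ^ 2 * M / (|A| / 2) ^ 4 := by
              gcongr; linarith
          _ = (48 / 25) * M / |A| ^ 2 := by field_simp; ring
          _ ≤ _ := by gcongr; norm_num
      calc |r / D ^ 2 - 6 * B * q / D ^ 3 + 12 * B ^ 2 * p / D ^ 4|
          ≤ |r / D ^ 2| + |6 * B * q / D ^ 3| + |12 * B ^ 2 * p / D ^ 4| :=
            (abs_add_le _ _).trans (by gcongr; exact abs_sub _ _)
        _ ≤ 4 * M / |A| ^ 2 + 5 * M / |A| ^ 2 + 2 * M / |A| ^ 2 := by gcongr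
        _ = 11 * M / |A| ^ 2 := by ring
    refine (intervalIntegral.norm_integral_le_of_norm_le_const hb).trans (le_of_eq ?_)
    rw [abs_of_pos (by norm_num : (0 : ℝ) < 2 - -2)]
    ring
  · intro s hs
    have hlin : HasDerivAt (fun s : ℝ => A + 2 * B * s) (2 * B) s := by
      simpa using ((hasDerivAt_id s).const_mul (2 * B)).const_add A
    have h := ((((hf' s).mul hlin).sub ((hf s).const_mul (2 * B))).div (hlin.pow 2)
      (pow_ne_zero 2 (hD s hs)))
    refine h.congr_deriv ?_
    have := hD s hs
    simp only [Pi.mul_apply, Pi.sub_apply, Pi.pow_apply]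
    generalize A + 2 * B * s = D at *
    field_simp
    push_cast
    ring
  · have hD3 : ∀ s ∈ uIcc (-2 : ℝ) 2, (A + 2 * B * s) ^ 3 ≠ 0 := fun s hs => pow_ne_zero 3 (hD s hs)
    exact (hf''.continuousOn.div (by fun_prop) hD).sub
      (ContinuousOn.div (by fun_prop) (by fun_prop) hD3)

/-- Second-derivative (van der Corput) decay of a quadratic oscillatory integral. -/
lemma norm_integral_mul_cexp_quadratic_le_of_stationary {A B M : ℝ} {f f' : ℝ → ℝ}
    (hB : B ≠ 0) (hf : ∀ s, HasDerivAt f (f' s) s) (hf' : Continuous f')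
    (hM : ∀ s ∈ Icc (-2 : ℝ) 2, |f s| ≤ M) (hM' : ∀ s ∈ Icc (-2 : ℝ) 2, |f' s| ≤ M)
    (h1 : f (-2) = 0) (h2 : f 2 = 0) :
    ‖∫ s in (-2 : ℝ)..2, (f s : ℂ) * Complex.exp (Complex.I * ((A * s + B * s ^ 2 : ℝ) : ℂ))‖ ≤
      M * (4 + 2 * π) / √|B| := by
  set e : ℝ → ℂ := fun s => Complex.exp (Complex.I * ((A * s + B * s ^ 2 : ℝ) : ℂ)) with he
  set u : ℝ → ℝ := fun s => s + A / (2 * B) with hu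
  set q : ℝ → ℂ := fun s => 1 + 2 * Complex.I * (B * (u s) ^ 2 : ℝ) with hq
  set b : ℝ := √|B| with hbdef
  have hb : 0 < b := Real.sqrt_pos.mpr (abs_pos.mpr hB)
  have hb2 : b ^ 2 = |B| := Real.sq_sqrt (abs_nonneg B)
  have hqn : ∀ s, ‖q s‖ ^ 2 = 1 + 4 * (b * u s) ^ 4 := by
    intro s
    rw [← Complex.normSq_eq_norm_sq, Complex.normSq_apply]
    have e4 : (b * u s) ^ 4 = (B * u s ^ 2) ^ 2 := by
      have : (b ^ 2) ^ 2 = B ^ 2 := by rw [hb2, sq_abs]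
      linear_combination (u s) ^ 4 * this
    rw [e4]
    simp [hq, -Complex.ofReal_mul, -Complex.ofReal_pow]
    ring
  have hq0 : ∀ s, q s ≠ 0 := by
    intro s h
    have := hqn s
    rw [h, norm_zero] at this
    nlinarith [sq_nonneg ((b * u s) ^ 2)]
  have hM0 : 0 ≤ M := (abs_nonneg _).trans (hM 0 (by norm_num))
  have hfc : Continuous f := continuous_iff_continuousAt.mpr fun s => (hf s).continuousAt
  have huc : Continuous u := by fun_prop
  have hqc : Continuous q := by fun_prop
  have hec : Continuous e := by fun_prop
  set R : ℝ → ℂ := fun s => (f' s : ℂ) * (u s / q s) * e s -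
    (f s : ℂ) * (4 * Complex.I * (B * (u s) ^ 2 : ℝ) / q s ^ 2) * e s with hR
  have hRc : Continuous R := by
    refine Continuous.sub ?_ ?_
    · exact ((Complex.continuous_ofReal.comp hf').mul
        ((Complex.continuous_ofReal.comp huc).div hqc hq0)).mul hec
    · refine ((Complex.continuous_ofReal.comp hfc).mul
        (Continuous.div (by fun_prop) (by fun_prop) fun s => pow_ne_zero 2 (hq0 s))).mul hec
  have hfe : Continuous fun s => (f s : ℂ) * e s := by fun_prop
  have hderiv : ∀ s, HasDerivAt (fun s => (f s : ℂ) * (u s / q s) * e s)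
      ((f s : ℂ) * e s + R s) s := by
    intro s
    have hud : HasDerivAt u 1 s := (hasDerivAt_id s).add_const _
    have hqd : HasDerivAt q (2 * Complex.I * (B * (2 * u s) : ℝ)) s := by
      have := (((hud.pow 2).const_mul B).ofReal_comp.const_mul (2 * Complex.I)).const_add 1
      refine this.congr_deriv ?_
      simp
    have h := (((hf s).ofReal_comp.mul (hud.ofReal_comp.div hqd (hq0 s))).mul
      (hasDerivAt_cexp_quadratic A B s))
    refine h.congr_deriv ?_
    have hθ : A + 2 * B * s = 2 * B * u s := by simp only [hu]; field_simp; ring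
    rw [hθ]
    change _ = (f s : ℂ) * e s + ((f' s : ℂ) * (u s / q s) * e s -
      (f s : ℂ) * (4 * Complex.I * (B * (u s) ^ 2 : ℝ) / q s ^ 2) * e s)
    simp only [Pi.div_apply, Pi.mul_apply]
    change (_ * (u s / q s) + _) * e s + (f s : ℂ) * (u s / q s) * (e s * _) = _
    have hqs : q s = 1 + 2 * Complex.I * (B * (u s) ^ 2 : ℝ) := rfl
    have hq0s := hq0 s
    have hB' : 2 * Complex.I * (B * (u s) ^ 2 : ℝ) = q s - 1 := by rw [hqs]; ring
    push_cast at hB' ⊢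
    generalize q s = Q at *
    generalize (u s : ℂ) = v at *
    generalize (f s : ℂ) = p at *
    generalize e s = w at *
    field_simp
    linear_combination p * w * Q * hB'
  have key := intervalIntegral.integral_eq_sub_of_hasDerivAt (a := -2) (b := 2)
    (fun s _ => hderiv s) ((hfe.add hRc).intervalIntegrable _ _)
  rw [intervalIntegral.integral_add (hfe.intervalIntegrable _ _) (hRc.intervalIntegrable _ _)] at key
  simp only [h1, h2, Complex.ofReal_zero, zero_mul, sub_zero] at key
  rw [eq_neg_of_add_eq_zero_left key, norm_neg]
  set G : ℝ → ℝ := fun s => M / b + 2 * M * (1 / (1 + (b * u s) ^ 2)) with hG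
  have hpos : ∀ s, 0 < 1 + (b * u s) ^ 2 := fun s => by positivity
  have hGc1 : Continuous fun s => 1 / (1 + (b * u s) ^ 2) :=
    Continuous.div (by fun_prop) (by fun_prop) fun s => (hpos s).ne'
  have hGc : Continuous G := by fun_prop
  have hRG : ∀ s ∈ Icc (-2 : ℝ) 2, ‖R s‖ ≤ G s := by
    intro s hs
    have hqp : 0 < ‖q s‖ := norm_pos_iff.mpr (hq0 s)
    have hes : ‖e s‖ = 1 := norm_cexp_I_mul_ofReal _
    have n1 : ‖(u s : ℂ) / q s‖ ≤ 1 / b := by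
      rw [norm_div, Complex.norm_real, Real.norm_eq_abs, div_le_div_iff₀ hqp hb]
      apply abs_le_of_sq_le_sq' _ (by positivity) |>.2
      rw [mul_pow, sq_abs, one_mul, hqn s]
      nlinarith [sq_nonneg ((b * u s) ^ 2 - 1), sq_nonneg ((b * u s) ^ 2)]
    have n2 : ‖4 * Complex.I * (B * (u s) ^ 2 : ℝ) / q s ^ 2‖ ≤
        2 * (1 / (1 + (b * u s) ^ 2)) := by
      rw [norm_div, norm_pow, hqn s, norm_mul, norm_mul, Complex.norm_I, Complex.norm_real,
        Real.norm_eq_abs, abs_mul, ← hb2, abs_of_nonneg (sq_nonneg (u s)), ← mul_pow,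
        mul_one_div, div_le_div_iff₀ (by positivity) (hpos s)]
      norm_num
      nlinarith [sq_nonneg (2 * (b * u s) ^ 2 - 1)]
    calc ‖R s‖ ≤ ‖(f' s : ℂ) * (u s / q s) * e s‖ +
          ‖(f s : ℂ) * (4 * Complex.I * (B * (u s) ^ 2 : ℝ) / q s ^ 2) * e s‖ := norm_sub_le _ _
      _ = |f' s| * ‖(u s : ℂ) / q s‖ + |f s| * ‖4 * Complex.I * (B * (u s) ^ 2 : ℝ) / q s ^ 2‖ := by
        simp only [norm_mul _ (e s), hes, mul_one]
        rw [norm_mul, norm_mul (f s : ℂ), Complex.norm_real, Complex.norm_real,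
          Real.norm_eq_abs, Real.norm_eq_abs]
      _ ≤ M * (1 / b) + M * (2 * (1 / (1 + (b * u s) ^ 2))) := by
        gcongr
        · exact hM' s hs
        · exact hM s hs
      _ = G s := by simp only [hG]; ring
  have harc : ∫ s in (-2 : ℝ)..2, 1 / (1 + (b * u s) ^ 2) ≤ π / b := by
    have hd : ∀ s, HasDerivAt (fun s => Real.arctan (b * u s) / b) (1 / (1 + (b * u s) ^ 2)) s := by
      intro s
      have hud : HasDerivAt u 1 s := (hasDerivAt_id s).add_const _
      refine ((hud.const_mul b).arctan.div_const b).congr_deriv ?_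
      field_simp
    rw [intervalIntegral.integral_eq_sub_of_hasDerivAt (fun s _ => hd s)
      (hGc1.intervalIntegrable _ _), ← sub_div]
    gcongr
    linarith [Real.arctan_lt_pi_div_two (b * u 2), Real.neg_pi_div_two_lt_arctan (b * u (-2))]
  calc ‖∫ s in (-2 : ℝ)..2, R s‖ ≤ ∫ s in (-2 : ℝ)..2, G s :=
        intervalIntegral.norm_integral_le_of_norm_le (by norm_num)
          (Filter.Eventually.of_forall fun s hs => hRG s ⟨hs.1.le, hs.2⟩)
          (hGc.intervalIntegrable _ _)
    _ = 4 * (M / b) + 2 * M * ∫ s in (-2 : ℝ)..2, 1 / (1 + (b * u s) ^ 2) := by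
        rw [intervalIntegral.integral_add (by simp)
          ((hGc1.intervalIntegrable _ _).const_mul _), intervalIntegral.integral_const_mul,
          intervalIntegral.integral_const, smul_eq_mul]
        norm_num
    _ ≤ 4 * (M / b) + 2 * M * (π / b) := by gcongr
    _ = M * (4 + 2 * π) / b := by ring

/-- Rescaling the oscillatory integral to unit frequency. -/
lemma oscInt_eq_scaled {μ₀ : ℝ → ℝ} (hsupp : Function.support μ₀ ⊆ Icc (-8/5 : ℝ) (8/5))
    (l : ℤ) (ξ y t : ℝ) :
    oscInt μ₀ l ξ y t = ((2 : ℝ) ^ l : ℝ) * ∫ s in (-2 : ℝ)..2, ((μ₀ s ^ 2 : ℝ) : ℂ) *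
      Complex.exp (Complex.I *
        (((y * 2 ^ l) * s + (t * (2 ^ l) ^ 2 / ξ) * s ^ 2 : ℝ) : ℂ)) := by
  have hL : (0 : ℝ) < 2 ^ l := by positivity
  set g : ℝ → ℂ := fun s => ((μ₀ s ^ 2 : ℝ) : ℂ) * Complex.exp (Complex.I *
        (((y * 2 ^ l) * s + (t * (2 ^ l) ^ 2 / ξ) * s ^ 2 : ℝ) : ℂ)) with hg
  have h1 : oscInt μ₀ l ξ y t = ∫ μ : ℝ, g (μ / 2 ^ l) := by
    unfold oscInt
    refine integral_congr_ae (Filter.Eventually.of_forall fun μ => ?_)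
    simp only [hg]
    congr 5 <;> field_simp
  have h2 : ∫ s in (-2 : ℝ)..2, g s = ∫ s, g s := by
    apply intervalIntegral.integral_eq_integral_of_support_subset
    intro s hs
    have hs0 : s ∈ Function.support μ₀ := by
      intro h
      exact hs (by simp [hg, h])
    have := hsupp hs0
    constructor <;> linarith [this.1, this.2]
  rw [h1, Measure.integral_comp_div, h2, abs_of_pos hL, Complex.real_smul]

theorem oscillatory_integral_decay_low_freq (μ₀ : ℝ → ℝ)
    (hsmooth : ContDiff ℝ (⊤ : ℕ∞) μ₀) (hrange : ∀ s, μ₀ s ∈ Icc (0:ℝ) 1)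
    (hsupp : Function.support μ₀ ⊆ Icc (-8/5 : ℝ) (8/5))
    (hone : ∀ s ∈ Icc (-5/4 : ℝ) (5/4 : ℝ), μ₀ s = 1)
    (heven : ∀ s, μ₀ (-s) = μ₀ s) :
    ∃ C : ℝ, 0 < C ∧ ∀ k l : ℤ, k ≤ 0 → 0 ≤ l → ∀ y t ξ : ℝ, |t| ≤ 1 →
      (2:ℝ) ^ (k - 2) ≤ |ξ| → |ξ| ≤ (2:ℝ) ^ (k + 2) →
      (100 * (2:ℝ) ^ (l - k) ≤ |y| →
          ‖oscInt μ₀ l ξ y t‖ ≤ C * (2:ℝ) ^ (l - k) * |y| ^ (-2 : ℝ)) ∧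
      (1 ≤ |y| → |y| ≤ 100 * (2:ℝ) ^ (l - k) →
          ‖oscInt μ₀ l ξ y t‖ ≤ C * (2:ℝ) ^ ((l : ℝ) / 2) * |y| ^ (-(1/2) : ℝ)) ∧
      (|y| ≤ 1 → ‖oscInt μ₀ l ξ y t‖ ≤ C * (2:ℝ) ^ l) := by
  set f : ℝ → ℝ := fun s => μ₀ s ^ 2 with hfdef
  have hfs : ContDiff ℝ (⊤ : ℕ∞) f := hsmooth.pow 2
  have hf1 : ContDiff ℝ (⊤ : ℕ∞) (deriv f) := (contDiff_infty_iff_deriv.mp hfs).2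
  have hf2 : ContDiff ℝ (⊤ : ℕ∞) (deriv (deriv f)) := (contDiff_infty_iff_deriv.mp hf1).2
  have hd : ∀ s, HasDerivAt f (deriv f s) s := fun s =>
    ((contDiff_infty_iff_deriv.mp hfs).1 s).hasDerivAt
  have hd' : ∀ s, HasDerivAt (deriv f) (deriv (deriv f) s) s := fun s =>
    ((contDiff_infty_iff_deriv.mp hf1).1 s).hasDerivAt
  have hts : tsupport f ⊆ Icc (-8/5 : ℝ) (8/5) :=
    closure_minimal (fun s hs => hsupp fun h => hs (by simp [hfdef, h])) isClosed_Icc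
  have hz : ∀ s, s ∉ Icc (-8/5 : ℝ) (8/5) → f s = 0 ∧ deriv f s = 0 := fun s hs =>
    ⟨image_eq_zero_of_notMem_tsupport fun h => hs (hts h),
      by_contra fun h => hs (hts (support_deriv_subset h))⟩
  have hzl := hz (-2) (by norm_num)
  have hzr := hz 2 (by norm_num)
  obtain ⟨M0, hM0⟩ := isCompact_Icc.exists_bound_of_continuousOn (s := Icc (-2 : ℝ) 2)
    hfs.continuous.continuousOn
  obtain ⟨M1, hM1⟩ := isCompact_Icc.exists_bound_of_continuousOn (s := Icc (-2 : ℝ) 2)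
    hf1.continuous.continuousOn
  obtain ⟨M2, hM2⟩ := isCompact_Icc.exists_bound_of_continuousOn (s := Icc (-2 : ℝ) 2)
    hf2.continuous.continuousOn
  set M : ℝ := max 1 (max M0 (max M1 M2)) with hMdef
  have hM1' : 1 ≤ M := le_max_left _ _
  have hMf : ∀ s ∈ Icc (-2 : ℝ) 2, |f s| ≤ M := fun s hs => (hM0 s hs).trans (by simp [hMdef])
  have hMf' : ∀ s ∈ Icc (-2 : ℝ) 2, |deriv f s| ≤ M := fun s hs =>
    (hM1 s hs).trans (by simp [hMdef])
  have hMf'' : ∀ s ∈ Icc (-2 : ℝ) 2, |deriv (deriv f) s| ≤ M := fun s hs =>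
    (hM2 s hs).trans (by simp [hMdef])
  refine ⟨100 * M, by positivity, fun k l hk hl y t ξ ht hξ _ => ?_⟩
  have hL1 : (1 : ℝ) ≤ 2 ^ l := one_le_zpow₀ (by norm_num) hl
  have hK : (0 : ℝ) < 2 ^ k := by positivity
  have hK1 : (2 : ℝ) ^ k ≤ 1 := zpow_le_one_of_nonpos₀ (by norm_num) hk
  have hlk : (2 : ℝ) ^ (l - k) = 2 ^ l / 2 ^ k := zpow_sub₀ (by norm_num) l k
  have hk2 : (2 : ℝ) ^ (k - 2) = 2 ^ k / 4 := by rw [zpow_sub₀ (by norm_num)]; norm_num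
  have hl2 : (2 : ℝ) ^ ((l : ℝ) / 2) = √(2 ^ l) := by
    rw [Real.sqrt_eq_rpow, ← Real.rpow_intCast, ← Real.rpow_mul (by norm_num)]
    congr 1; ring
  rw [oscInt_eq_scaled hsupp, norm_mul, Complex.norm_real, hlk, hl2,
    Real.norm_of_nonneg (zero_le_one.trans hL1)]
  rw [hk2] at hξ
  generalize (2 : ℝ) ^ l = L at *
  generalize (2 : ℝ) ^ k = K at *
  have hL : 0 < L := by linarith
  set A := y * L with hA
  set B := t * L ^ 2 / ξ with hB
  have hAabs : |A| = |y| * L := by rw [hA, abs_mul, abs_of_pos hL]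
  have nonstat : A ≠ 0 → 10 * |B| ≤ |A| → _ := fun h1 h2 =>
    norm_integral_mul_cexp_quadratic_le_of_nonstationary h1 h2 hd hd' hf2.continuous
      hMf hMf' hMf'' hzl.1 hzr.1 hzl.2 hzr.2
  refine ⟨fun hy => ?_, fun hy _ => ?_, fun _ => ?_⟩
  · have hLK : 0 < L / K := by positivity
    have hy0 : 0 < |y| := by linarith
    have hξ0 : 0 < |ξ| := by linarith
    have hBle : 10 * |B| ≤ |A| := by
      have e1 : |B| ≤ 4 * (L / K) * L := by
        rw [hB, abs_div, abs_mul, abs_of_pos (by positivity : 0 < L ^ 2)]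
        calc |t| * L ^ 2 / |ξ| ≤ 1 * L ^ 2 / (K / 4) := by gcongr
          _ = _ := by field_simp
      rw [hAabs]
      nlinarith
    refine (mul_le_mul_of_nonneg_left
      (nonstat (abs_pos.mp (by rw [hAabs]; positivity)) hBle) hL.le).trans ?_
    rw [Real.rpow_neg hy0.le, Real.rpow_two, hAabs]
    have e2 : L * (44 * M / (|y| * L) ^ 2) = 44 * M * (1 / L) * (|y| ^ 2)⁻¹ := by field_simp
    rw [e2]
    have e3 : 1 / L ≤ L / K := by
      rw [div_le_div_iff₀ hL hK]; nlinarith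
    gcongr
    norm_num
  · have hy0 : 0 < |y| := by linarith
    have hA1 : 1 ≤ |A| := by rw [hAabs]; nlinarith
    have hA0 : 0 < |A| := by linarith
    have hsq : 1 ≤ √|A| := Real.one_le_sqrt.mpr hA1
    have hsq2 : √|A| ^ 2 = |A| := Real.sq_sqrt hA0.le
    suffices h : ‖∫ s in (-2 : ℝ)..2, (f s : ℂ) *
        Complex.exp (Complex.I * ((A * s + B * s ^ 2 : ℝ) : ℂ))‖ ≤ 100 * M / √|A| by
      refine (mul_le_mul_of_nonneg_left h hL.le).trans (le_of_eq ?_)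
      rw [Real.rpow_neg hy0.le, ← Real.sqrt_eq_rpow, hAabs, Real.sqrt_mul hy0.le]
      have hs0 : 0 < √L := Real.sqrt_pos.mpr hL
      have hs1 : 0 < √|y| := Real.sqrt_pos.mpr hy0
      have hs2 : √L ^ 2 = L := Real.sq_sqrt hL.le
      field_simp
      linear_combination -hs2
    by_cases hBA : 10 * |B| ≤ |A|
    · refine (nonstat (abs_pos.mp hA0) hBA).trans ?_
      gcongr
      · norm_num
      · nlinarith
    · push Not at hBA
      have hB0 : 0 < |B| := by linarith
      refine (norm_integral_mul_cexp_quadratic_le_of_stationary (abs_pos.mp hB0) hd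
        hf1.continuous hMf hMf' hzl.1 hzr.1).trans ?_
      have hsB : √|A| ≤ 4 * √|B| := by
        rw [Real.sqrt_le_left (by positivity), mul_pow, Real.sq_sqrt hB0.le]
        linarith
      rw [div_le_div_iff₀ (Real.sqrt_pos.mpr hB0) (by linarith)]
      have hπ : 4 + 2 * π ≤ 12 := by linarith [Real.pi_le_four]
      calc M * (4 + 2 * π) * √|A| ≤ M * 12 * (4 * √|B|) := by gcongr
        _ ≤ 100 * M * √|B| := by nlinarith [mul_nonneg (zero_le_one.trans hM1') (Real.sqrt_nonneg |B|)]
  · have h : ‖∫ s in (-2 : ℝ)..2, (f s : ℂ) *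
        Complex.exp (Complex.I * ((A * s + B * s ^ 2 : ℝ) : ℂ))‖ ≤ M * |2 - (-2 : ℝ)| := by
      refine intervalIntegral.norm_integral_le_of_norm_le_const fun s hs => ?_
      rw [uIoc_of_le (by norm_num)] at hs
      rw [norm_mul, norm_cexp_I_mul_ofReal, mul_one, Complex.norm_real]
      exact hMf s ⟨hs.1.le, hs.2⟩
    rw [abs_of_pos (by norm_num : (0 : ℝ) < 2 - -2)] at h
    refine (mul_le_mul_of_nonneg_left h hL.le).trans ?_
    nlinarith [mul_pos hL (zero_lt_one.trans_le hM1')]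
end
end

section
/- There exists a universal constant C > 0 such that for all integers k ≤ 0 and l ≥ 0, all m ∈ ℝ with |m| ≤ 2^{l−k+3}, and each sign σ ∈ {+1, −1}, ∫_ℝ sup_{x ∈ ℝ, |t| ≤ 1} | ∫_{ℝ²} χ_{[k−1,k+1]}(ξ)² · μ₀(2^l(μ/ξ + σ√3ξ − m))² · e^{i(xξ + yμ + tω(ξ,μ))} dξ dμ | dy ≤ C · 2^k. -/
open MeasureTheory Real Set

noncomputable section

/-- `χ_m(ξ) = μ₀(ξ/2^m) − μ₀(ξ/2^{m−1})`. -/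
def chi (μ₀ : ℝ → ℝ) (m : ℤ) (ξ : ℝ) : ℝ := μ₀ (ξ / 2 ^ m) - μ₀ (ξ / 2 ^ (m - 1))

/-- `χ_{[k₁,k₂]} = Σ_{m=k₁}^{k₂} χ_m`. -/
def chiI (μ₀ : ℝ → ℝ) (k₁ k₂ : ℤ) (ξ : ℝ) : ℝ := ∑ m ∈ Finset.Icc k₁ k₂, chi μ₀ m ξ

/-- Quadratic decay of an oscillatory integral with amplitude `g` and phase `A s + B s²`,
uniformly for bounded `B`. -/
lemma exists_norm_integral_mul_cexp_quadratic_le {g : ℝ → ℂ} (hg : ContDiff ℝ 2 g)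
    (hc : HasCompactSupport g) :
    ∃ C : ℝ, 0 < C ∧ ∀ A B : ℝ, |B| ≤ 4 →
      ‖∫ s : ℝ, g s * Complex.exp (Complex.I * ((A * s + B * s ^ 2 : ℝ) : ℂ))‖ ≤
        C / (1 + A ^ 2) := by
  have hg1 : ContDiff ℝ 1 (deriv g) := ContDiff.deriv' (n := 1) hg
  have hg2 : Continuous (deriv (deriv g)) := hg1.continuous_deriv le_rfl
  have hgc : Continuous g := hg.continuous
  have hg1c : Continuous (deriv g) := hg1.continuous
  have hc1 : HasCompactSupport (deriv g) := hc.deriv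
  have hc2 : HasCompactSupport (deriv (deriv g)) := hc1.deriv
  have hd (s : ℝ) : HasDerivAt g (deriv g s) s := (hg.differentiable (by norm_num) s).hasDerivAt
  have hd1 (s : ℝ) : HasDerivAt (deriv g) (deriv (deriv g) s) s :=
    (hg1.differentiable (by norm_num) s).hasDerivAt
  set D : ℝ → ℝ := fun s ↦ ‖deriv (deriv g) s‖ + 16 * |s| * ‖deriv g s‖ +
    (9 + 64 * s ^ 2) * ‖g s‖ with hD
  have hDi : Integrable D := by
    refine Continuous.integrable_of_hasCompactSupport (by fun_prop) ?_
    exact (hc2.norm.add hc1.norm.mul_left).add hc.norm.mul_left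
  have hD0 : 0 ≤ ∫ s, D s := integral_nonneg fun s ↦ by positivity
  refine ⟨(∫ s, D s) + 1, by positivity, fun A B hB ↦ ?_⟩
  set e : ℝ → ℂ := fun s ↦ Complex.exp (Complex.I * ((A * s + B * s ^ 2 : ℝ) : ℂ)) with he
  have hen (s : ℝ) : ‖e s‖ = 1 := by
    simp only [he]; rw [mul_comm]; exact Complex.norm_exp_ofReal_mul_I _
  have hec : Continuous e := by fun_prop
  have hed (s : ℝ) : HasDerivAt e (Complex.I * (A + 2 * B * s) * e s) s := by
    have h1 : HasDerivAt (fun s : ℝ ↦ A * s + B * s ^ 2) (A + 2 * B * s) s := by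
      refine (((hasDerivAt_id' s).const_mul A).add ((hasDerivAt_pow 2 s).const_mul B)).congr_deriv ?_
      norm_num; ring
    have := (h1.ofReal_comp.const_mul Complex.I).cexp
    refine this.congr_deriv ?_
    push_cast [he]; ring
  set b : ℝ → ℂ := fun s ↦ deriv (deriv g) s + 4 * Complex.I * B * s * deriv g s +
    (2 * Complex.I * B - 4 * B ^ 2 * s ^ 2) * g s with hb
  have hbc : Continuous b := by fun_prop
  have hbs : HasCompactSupport b := (hc2.add hc1.mul_left).add hc.mul_left
  have hbi : Integrable fun s ↦ b s * e s :=
    (hbc.mul hec).integrable_of_hasCompactSupport hbs.mul_right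
  have hgi : Integrable fun s ↦ g s * e s :=
    (hgc.mul hec).integrable_of_hasCompactSupport hc.mul_right
  have hHd (s : ℝ) : HasDerivAt
      (fun s : ℝ ↦ (deriv g s + (2 * Complex.I * B * s - Complex.I * A) * g s) * e s)
      (b s * e s + A ^ 2 * (g s * e s)) s := by
    have hl : HasDerivAt (fun s : ℝ ↦ 2 * Complex.I * B * s - Complex.I * A)
        (2 * Complex.I * B) s := by
      have := ((hasDerivAt_id s).ofReal_comp.const_mul (2 * Complex.I * B)).sub_const
        (Complex.I * A)
      simpa using this
    refine (((hd1 s).add (hl.mul (hd s))).mul (hed s)).congr_deriv ?_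
    simp only [hb, Pi.add_apply, Pi.mul_apply]
    linear_combination (4 * B ^ 2 * s ^ 2 * g s * e s - A ^ 2 * g s * e s) * Complex.I_sq
  have hHc : Continuous
      fun s : ℝ ↦ (deriv g s + (2 * Complex.I * B * s - Complex.I * A) * g s) * e s := by
    fun_prop
  have hHi := hHc.integrable_of_hasCompactSupport (μ := volume)
    ((hc1.add (hc.mul_left (f := fun s : ℝ ↦ 2 * Complex.I * B * s - Complex.I * A))).mul_right
      (f' := e))
  have h0 := integral_eq_zero_of_hasDerivAt_of_integrable hHd
    (hbi.add (hgi.const_mul ((A : ℂ) ^ 2))) hHi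
  rw [integral_add hbi (hgi.const_mul _), integral_const_mul] at h0
  have hkey : ((1 + A ^ 2 : ℝ) : ℂ) * ∫ s, g s * e s = ∫ s, (g s - b s) * e s := by
    simp only [sub_mul]
    rw [integral_sub hgi hbi]
    push_cast
    linear_combination h0
  have hbound : ‖∫ s, (g s - b s) * e s‖ ≤ ∫ s, D s := by
    refine norm_integral_le_of_norm_le hDi (Filter.Eventually.of_forall fun s ↦ ?_)
    rw [norm_mul, hen, mul_one]
    have h1 : ‖4 * Complex.I * B * s * deriv g s‖ ≤ 16 * |s| * ‖deriv g s‖ := by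
      simp only [norm_mul, Complex.norm_I, Complex.norm_real, Complex.norm_ofNat, norm_eq_abs]
      gcongr
      linarith
    have h2 : ‖(2 * Complex.I * B - 4 * B ^ 2 * s ^ 2) * g s‖ ≤ (8 + 64 * s ^ 2) * ‖g s‖ := by
      rw [norm_mul]
      gcongr
      refine (norm_sub_le _ _).trans ?_
      simp only [norm_mul, norm_pow, Complex.norm_I, Complex.norm_real, Complex.norm_ofNat,
        norm_eq_abs, sq_abs]
      have : B ^ 2 ≤ 16 := by nlinarith [abs_nonneg B, sq_abs B]
      gcongr
      · linarith
      · linarith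
    calc ‖g s - b s‖ ≤ ‖g s‖ + ‖b s‖ := norm_sub_le _ _
      _ ≤ ‖g s‖ + (‖deriv (deriv g) s‖ + 16 * |s| * ‖deriv g s‖ + (8 + 64 * s ^ 2) * ‖g s‖) := by
        gcongr
        exact (norm_add₃_le ..).trans (by gcongr)
      _ = D s := by simp only [hD]; ring
  have hpos : (0 : ℝ) < 1 + A ^ 2 := by positivity
  rw [le_div_iff₀ hpos]
  rw [← hkey, norm_mul, Complex.norm_real, norm_of_nonneg hpos.le] at hbound
  linarith

lemma chiI_pred_succ (μ₀ : ℝ → ℝ) (k : ℤ) (ξ : ℝ) :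
    chiI μ₀ (k - 1) (k + 1) ξ = μ₀ (ξ / (2 * 2 ^ k)) - μ₀ (ξ / (2 ^ k / 4)) := by
  have h : Finset.Icc (k - 1) (k + 1) = {k - 1, k, k + 1} := by
    ext; simp only [Finset.mem_Icc, Finset.mem_insert, Finset.mem_singleton]; omega
  have h1 : (2 : ℝ) ^ (k + 1) = 2 * 2 ^ k := by rw [zpow_add₀ two_ne_zero]; ring
  have h2 : (2 : ℝ) ^ (k - 1 - 1) = 2 ^ k / 4 := by
    rw [sub_sub, zpow_sub₀ two_ne_zero]; norm_num
  rw [chiI, h, Finset.sum_insert (by simp; omega), Finset.sum_insert (by simp),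
    Finset.sum_singleton]
  simp only [chi, h2, add_sub_cancel_right, h1]
  ring

lemma abs_chiI_pred_succ_le_one {μ₀ : ℝ → ℝ} (hrange : ∀ s, μ₀ s ∈ Icc (0:ℝ) 1) (k : ℤ) (ξ : ℝ) :
    |chiI μ₀ (k - 1) (k + 1) ξ| ≤ 1 := by
  rw [chiI_pred_succ]
  have h1 := hrange (ξ / (2 * 2 ^ k))
  have h2 := hrange (ξ / (2 ^ k / 4))
  exact abs_le.2 ⟨by linarith [h1.1, h2.2], by linarith [h1.2, h2.1]⟩

lemma abs_mem_Icc_of_chiI_ne_zero {μ₀ : ℝ → ℝ}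
    (hsupp : Function.support μ₀ ⊆ Icc (-8/5 : ℝ) (8/5))
    (hone : ∀ s ∈ Icc (-5/4 : ℝ) (5/4 : ℝ), μ₀ s = 1) {k : ℤ} {ξ : ℝ}
    (h : chiI μ₀ (k - 1) (k + 1) ξ ≠ 0) : |ξ| ∈ Icc ((2:ℝ) ^ k / 4) (4 * 2 ^ k) := by
  have hK : (0:ℝ) < 2 ^ k := by positivity
  have hzero : ∀ s : ℝ, 8/5 < |s| → μ₀ s = 0 := fun s hs ↦ by
    by_contra hne
    have := hsupp hne
    exact hs.not_ge (abs_le.2 ⟨by linarith [this.1], this.2⟩)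
  have hone' : ∀ s : ℝ, |s| ≤ 5/4 → μ₀ s = 1 := fun s hs ↦
    hone s ⟨by linarith [(abs_le.1 hs).1], (abs_le.1 hs).2⟩
  have hdiv {a b : ℝ} (ha : 0 < a) (hb : |ξ| ≤ b * a) : |ξ / a| ≤ b := by
    rwa [abs_div, abs_of_pos ha, div_le_iff₀ ha]
  have hdiv' {a b : ℝ} (ha : 0 < a) (hb : b * a < |ξ|) : b < |ξ / a| := by
    rwa [abs_div, abs_of_pos ha, lt_div_iff₀ ha]
  have hK2 : (0:ℝ) < 2 * 2 ^ k := by positivity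
  have hK4 : (0:ℝ) < 2 ^ k / 4 := by positivity
  rw [chiI_pred_succ] at h
  constructor
  · by_contra! hlt
    refine h ?_
    rw [hone' _ (hdiv hK2 (by linarith)), hone' _ (hdiv hK4 (by linarith)), sub_self]
  · by_contra! hlt
    refine h ?_
    rw [hzero _ (hdiv' hK2 (by linarith)), hzero _ (hdiv' hK4 (by linarith)), sub_self]

/-- The affine change of variables `s = L (μ/ξ + c)` in the `μ`-integral of the kernel. -/
lemma norm_integral_slice_eq (h : ℝ → ℝ) (a : ℝ) {ξ L : ℝ} (hξ : ξ ≠ 0) (hL : 0 < L)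
    (c x y t : ℝ) :
    ‖∫ μ : ℝ, ((a * h (L * (μ / ξ + c)) : ℝ) : ℂ) *
        Complex.exp (Complex.I * ((x * ξ + y * μ + t * disp ξ μ : ℝ) : ℂ))‖ =
      |a| * (|ξ| / L) * ‖∫ s : ℝ, (h s : ℂ) * Complex.exp (Complex.I *
        ((ξ / L * (y - 2 * t * c) * s + t * ξ / L ^ 2 * s ^ 2 : ℝ) : ℂ))‖ := by
  set G : ℝ → ℂ := fun s ↦ (h s : ℂ) * Complex.exp (Complex.I *
        ((ξ / L * (y - 2 * t * c) * s + t * ξ / L ^ 2 * s ^ 2 : ℝ) : ℂ)) with hG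
  set θ : ℝ := x * ξ + t * ξ ^ 3 - y * ξ * c + t * ξ * c ^ 2 with hθ
  have hpt (μ : ℝ) : ((a * h (L * (μ / ξ + c)) : ℝ) : ℂ) *
        Complex.exp (Complex.I * ((x * ξ + y * μ + t * disp ξ μ : ℝ) : ℂ)) =
      (a * Complex.exp (θ * Complex.I)) * G (L / ξ * μ + L * c) := by
    have harg : L * (μ / ξ + c) = L / ξ * μ + L * c := by ring
    have hph : x * ξ + y * μ + t * disp ξ μ = θ +
        (ξ / L * (y - 2 * t * c) * (L / ξ * μ + L * c) +
          t * ξ / L ^ 2 * (L / ξ * μ + L * c) ^ 2) := by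
      simp only [disp, hθ]; field_simp; ring
    rw [harg, hph, hG, Complex.ofReal_mul, Complex.ofReal_add, mul_add, Complex.exp_add,
      mul_comm Complex.I (θ : ℂ)]
    ring
  have hcv : ∫ μ : ℝ, G (L / ξ * μ + L * c) = |(L / ξ)⁻¹| • ∫ s, G s := by
    rw [Measure.integral_comp_mul_left (fun v ↦ G (v + L * c)),
      integral_add_right_eq_self]
  simp_rw [hpt]
  rw [integral_const_mul, hcv, norm_mul, norm_mul, norm_smul, Complex.norm_real,
    Complex.norm_exp_ofReal_mul_I, inv_div, norm_eq_abs, norm_eq_abs, abs_abs, abs_div,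
    abs_of_pos hL]
  ring

/-- On the frequency support, `ξ (y - 2 t c) / L` controls `K y / L`. -/
lemma one_add_sq_le_of_frequency_bounds {K L ξ m σ t y : ℝ} (hK : 0 < K) (hK1 : K ≤ 1)
    (hL : 1 ≤ L) (hξ : |ξ| ∈ Icc (K / 4) (4 * K)) (hm : |m| ≤ 8 * L / K) (hσ : |σ| = 1)
    (ht : |t| ≤ 1) :
    1 + (K / L * y) ^ 2 ≤ 2049 * (1 + (ξ / L * (y - 2 * t * (σ * √3 * ξ - m))) ^ 2) := by
  have hL0 : 0 < L := by linarith
  set c := σ * √3 * ξ - m with hc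
  have h3 : √3 ≤ 2 := by rw [sqrt_le_left (by norm_num)]; norm_num
  have hKL : K ≤ L / K := by rw [le_div_iff₀ hK]; nlinarith
  have hcb : |c| ≤ 16 * (L / K) := by
    have h1 : |σ * √3 * ξ| ≤ 2 * (4 * K) := by
      rw [abs_mul, abs_mul, hσ, one_mul, abs_of_nonneg (sqrt_nonneg 3)]
      exact mul_le_mul h3 hξ.2 (abs_nonneg _) (by norm_num)
    calc |c| ≤ |σ * √3 * ξ| + |m| := abs_sub _ _
      _ ≤ 2 * (4 * K) + 8 * L / K := add_le_add h1 hm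
      _ ≤ 16 * (L / K) := by rw [mul_div_assoc]; linarith
  have htc : |2 * t * c| ≤ 32 * (L / K) := by
    rw [abs_mul, abs_mul, abs_two]
    nlinarith [abs_nonneg t, abs_nonneg c]
  set A := ξ / L * (y - 2 * t * c) with hA
  have hAb : K / (4 * L) * |y - 2 * t * c| ≤ |A| := by
    rw [hA, abs_mul, abs_div, abs_of_pos hL0]
    refine mul_le_mul_of_nonneg_right ?_ (abs_nonneg _)
    rw [← div_div]
    gcongr
    exact hξ.1
  have hY : |K / L * y| ≤ 4 * |A| + 32 := by
    have h1 : |y| ≤ |y - 2 * t * c| + 32 * (L / K) := by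
      have := abs_add_le (y - 2 * t * c) (2 * t * c)
      rw [sub_add_cancel] at this
      linarith
    calc |K / L * y| = K / L * |y| := by rw [abs_mul, abs_of_pos (by positivity)]
      _ ≤ K / L * (|y - 2 * t * c| + 32 * (L / K)) := by gcongr
      _ = 4 * (K / (4 * L) * |y - 2 * t * c|) + 32 := by field_simp
      _ ≤ 4 * |A| + 32 := by gcongr
  have hsq : (K / L * y) ^ 2 ≤ (4 * |A| + 32) ^ 2 := by
    rw [← sq_abs (K / L * y)]; gcongr
  nlinarith [sq_abs A, sq_nonneg (4 * |A| - 32), hsq]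

theorem kernel_maximal_L1_bound_angular_low_freq (μ₀ : ℝ → ℝ)
    (hsmooth : ContDiff ℝ (⊤ : ℕ∞) μ₀) (hrange : ∀ s, μ₀ s ∈ Icc (0:ℝ) 1)
    (hsupp : Function.support μ₀ ⊆ Icc (-8/5 : ℝ) (8/5))
    (hone : ∀ s ∈ Icc (-5/4 : ℝ) (5/4 : ℝ), μ₀ s = 1)
    (heven : ∀ s, μ₀ (-s) = μ₀ s) :
    ∃ C : ℝ, 0 < C ∧ ∀ k l : ℤ, k ≤ 0 → 0 ≤ l →
      ∀ m σ : ℝ, |m| ≤ (2:ℝ) ^ (l - k + 3) → (σ = 1 ∨ σ = -1) →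
      ∫ y : ℝ,
        ⨆ (x : ℝ) (t : ℝ) (_ : |t| ≤ 1),
          ‖∫ q : ℝ × ℝ,
            (((chiI μ₀ (k - 1) (k + 1) q.1) ^ 2 *
                (μ₀ ((2:ℝ) ^ l * (q.2 / q.1 + σ * Real.sqrt 3 * q.1 - m))) ^ 2 : ℝ) : ℂ) *
              Complex.exp (Complex.I * ((x * q.1 + y * q.2 + t * disp q.1 q.2 : ℝ) : ℂ))‖ ≤
        C * (2:ℝ) ^ k := by
  have hμc : HasCompactSupport μ₀ :=
    HasCompactSupport.of_support_subset_isCompact isCompact_Icc hsupp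
  obtain ⟨C, hC, hdecay⟩ := exists_norm_integral_mul_cexp_quadratic_le
    (g := fun s ↦ ((μ₀ s ^ 2 : ℝ) : ℂ))
    (Complex.ofRealCLM.contDiff.comp ((hsmooth.of_le (WithTop.coe_le_coe.2 le_top)).pow 2))
    (hμc.comp_left (g := fun r : ℝ ↦ ((r ^ 2 : ℝ) : ℂ)) (by simp))
  refine ⟨65568 * C * π, by positivity, fun k l hk hl m σ hm hσ ↦ ?_⟩
  have hm' : |m| ≤ 8 * 2 ^ l / 2 ^ k := by
    rwa [zpow_add₀ two_ne_zero, zpow_sub₀ two_ne_zero, mul_comm, ← mul_div_assoc,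
      show (2:ℝ) ^ (3:ℤ) = 8 by norm_num] at hm
  have hσ' : |σ| = 1 := by rcases hσ with rfl | rfl <;> simp
  have hK : (0:ℝ) < 2 ^ k := by positivity
  have hK1 : (2:ℝ) ^ k ≤ 1 := zpow_le_one_of_nonpos₀ one_le_two hk
  have hL : (1:ℝ) ≤ 2 ^ l := one_le_zpow₀ one_le_two hl
  generalize (2:ℝ) ^ l = L at hm' hL ⊢
  have hfreq (ξ : ℝ) := abs_mem_Icc_of_chiI_ne_zero hsupp hone (k := k) (ξ := ξ)
  have hchi (ξ : ℝ) := abs_chiI_pred_succ_le_one hrange k ξ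
  generalize chiI μ₀ (k - 1) (k + 1) = χ at hfreq hchi ⊢
  generalize (2:ℝ) ^ k = K at hm' hK hK1 hfreq ⊢
  have hL0 : 0 < L := by linarith
  have hslice (ξ x y t : ℝ) (ht : |t| ≤ 1) :
      ‖∫ μ : ℝ, ((χ ξ ^ 2 * μ₀ (L * (μ / ξ + σ * √3 * ξ - m)) ^ 2 : ℝ) : ℂ) *
        Complex.exp (Complex.I * ((x * ξ + y * μ + t * disp ξ μ : ℝ) : ℂ))‖ ≤
      (Icc (-(4 * K)) (4 * K)).indicator
        (fun _ ↦ 8196 * C * K / L * (1 + (K / L * y) ^ 2)⁻¹) ξ := by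
    by_cases h0 : χ ξ = 0
    · simp only [h0]
      simp only [ne_eq, OfNat.ofNat_ne_zero, not_false_eq_true, zero_pow, zero_mul,
        Complex.ofReal_zero, integral_zero, norm_zero]
      exact indicator_nonneg (fun _ _ ↦ by positivity) _
    have hξ := hfreq ξ h0
    have hξ0 : ξ ≠ 0 := by
      rintro rfl
      have := hξ.1
      rw [abs_zero] at this
      linarith
    rw [indicator_of_mem (mem_Icc.2 (abs_le.1 hξ.2))]
    simp only [add_sub_assoc]
    rw [norm_integral_slice_eq (fun s ↦ μ₀ s ^ 2) (χ ξ ^ 2) hξ0 hL0]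
    have hB : |t * ξ / L ^ 2| ≤ 4 := by
      rw [abs_div, abs_mul, abs_of_pos (by positivity : 0 < L ^ 2), div_le_iff₀ (by positivity)]
      have : |t| * |ξ| ≤ 1 * (4 * 1) := by
        gcongr
        exact hξ.2.trans (by gcongr)
      nlinarith
    have hA := one_add_sq_le_of_frequency_bounds (y := y) hK hK1 hL hξ hm' hσ' ht
    have hsq : |χ ξ ^ 2| ≤ 1 := by
      rw [abs_pow]; exact pow_le_one₀ (abs_nonneg _) (hchi ξ)
    set A := ξ / L * (y - 2 * t * (σ * √3 * ξ - m))
    have hAinv : C / (1 + A ^ 2) ≤ C * (2049 * (1 + (K / L * y) ^ 2)⁻¹) := by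
      rw [div_eq_mul_inv]
      gcongr
      rw [← div_eq_mul_inv, inv_eq_one_div, div_le_div_iff₀ (by positivity) (by positivity)]
      linarith
    calc _ ≤ 1 * (4 * K / L) * (C * (2049 * (1 + (K / L * y) ^ 2)⁻¹)) := by
          gcongr
          · exact hξ.2
          · exact (hdecay A _ hB).trans hAinv
      _ = _ := by ring
  have hker (x y t : ℝ) (ht : |t| ≤ 1) :
      ‖∫ q : ℝ × ℝ, ((χ q.1 ^ 2 * μ₀ (L * (q.2 / q.1 + σ * √3 * q.1 - m)) ^ 2 : ℝ) : ℂ) *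
        Complex.exp (Complex.I * ((x * q.1 + y * q.2 + t * disp q.1 q.2 : ℝ) : ℂ))‖ ≤
      65568 * C * K ^ 2 / L * (1 + (K / L * y) ^ 2)⁻¹ := by
    by_cases hi : Integrable fun q : ℝ × ℝ ↦
      ((χ q.1 ^ 2 * μ₀ (L * (q.2 / q.1 + σ * √3 * q.1 - m)) ^ 2 : ℝ) : ℂ) *
        Complex.exp (Complex.I * ((x * q.1 + y * q.2 + t * disp q.1 q.2 : ℝ) : ℂ))
    · rw [Measure.volume_eq_prod] at hi ⊢
      rw [integral_prod _ hi]
      refine (norm_integral_le_of_norm_le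
        ((integrable_indicator_iff measurableSet_Icc).2 continuousOn_const.integrableOn_Icc)
        (Filter.Eventually.of_forall fun ξ ↦ hslice ξ x y t ht)).trans_eq ?_
      rw [integral_indicator measurableSet_Icc, setIntegral_const, measureReal_def,
        Real.volume_Icc, ENNReal.toReal_ofReal (by linarith), smul_eq_mul]
      ring
    · rw [integral_undef hi, norm_zero]
      positivity
  have hint : Integrable fun y : ℝ ↦ 65568 * C * K ^ 2 / L * (1 + (K / L * y) ^ 2)⁻¹ :=
    (integrable_inv_one_add_sq.comp_mul_left' (by positivity)).const_mul _
  calc _ ≤ ∫ y : ℝ, 65568 * C * K ^ 2 / L * (1 + (K / L * y) ^ 2)⁻¹ := by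
        refine integral_mono_of_nonneg (Filter.Eventually.of_forall fun y ↦ ?_) hint
          (Filter.Eventually.of_forall fun y ↦ ?_)
        · exact Real.iSup_nonneg fun x ↦ Real.iSup_nonneg fun t ↦ Real.iSup_nonneg fun _ ↦
            norm_nonneg _
        · have h0 : 0 ≤ 65568 * C * K ^ 2 / L * (1 + (K / L * y) ^ 2)⁻¹ := by positivity
          exact Real.iSup_le (fun x ↦ Real.iSup_le (fun t ↦ Real.iSup_le
            (fun ht ↦ hker x y t ht) h0) h0) h0
    _ = 65568 * C * π * K := by
        rw [integral_const_mul, Measure.integral_comp_mul_left (fun v ↦ (1 + v ^ 2)⁻¹),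
          integral_univ_inv_one_add_sq, abs_of_pos (by positivity), smul_eq_mul]
        field_simp
end
end
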